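/- Let r₀, E₀ > 0 and D₀ > 1. There exists a constant c > 0, depending only on r₀, E₀, D₀, such that for every Lipschitz cavity C with parameters r₀, E₀, D₀ and every continuously differentiable u : Ω → ℝ³ on Ω = ℝ³₋ \ C̄ with ∫_Ω |u|²/(1+|x|²) dx < ∞ and ∫_Ω |∇u|² dx < ∞, one has ∫_Ω |u(x)|²/(1+|x|²) dx ≤ c ∫_Ω |∇u(x)|² dx. -/

import Mathlib

open MeasureTheory Metric Set

noncomputable section

abbrev E3 := EuclideanSpace ℝ (Fin 3)
abbrev E2 := EuclideanSpace ℝ (Fin 2)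

/-- The open lower half-space `{x : x₃ < 0}`. -/
def lowerHalf : Set E3 := {x | x 2 < 0}

/-- The lower half-ball `B⁻_r(0) = {|x| < r, x₃ < 0}`. -/
def negBall (r : ℝ) : Set E3 := {x | ‖x‖ < r ∧ x 2 < 0}

/-- Jacobian matrix of a vector field: `(jac u x) i j = ∂uᵢ/∂xⱼ (x)`. -/
def jac (u : E3 → E3) (x : E3) : Matrix (Fin 3) (Fin 3) ℝ :=
  fun i j => fderiv ℝ u x (EuclideanSpace.single j 1) i

/-- Symmetric part of the Jacobian (strain tensor) `∇̂u`. -/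
def strain (u : E3 → E3) (x : E3) : Matrix (Fin 3) (Fin 3) ℝ :=
  fun i j => (jac u x i j + jac u x j i) / 2

/-- Squared Frobenius norm of a 3×3 matrix. -/
def frob2 (M : Matrix (Fin 3) (Fin 3) ℝ) : ℝ := ∑ i, ∑ j, (M i j)^2

/-- Divergence of a vector field. -/
def divg (u : E3 → E3) (x : E3) : ℝ := ∑ i, jac u x i i

/-- Projection on the first two coordinates. -/
def proj12 (x : E3) : E2 :=
  (x 0) • EuclideanSpace.single 0 1 + (x 1) • EuclideanSpace.single 1 1

/-- Embedding of the plane `{x₃ = 0}` into `ℝ³`: `x' ↦ (x'₁, x'₂, 0)`. -/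
def emb2 (x' : E2) : E3 :=
  (x' 0) • EuclideanSpace.single 0 1 + (x' 1) • EuclideanSpace.single 1 1

/-- Partial derivative of a scalar field in the k-th coordinate direction. -/
def pd (f : E3 → ℝ) (k : Fin 3) (x : E3) : ℝ := fderiv ℝ f x (EuclideanSpace.single k 1)

/-- `S` has boundary of Lipschitz class with constants r₀, E₀: at each boundary point `P`,
after a rigid change of coordinates sending `P` to `0`, the set is locally the open
epigraph of a Lipschitz function `ψ` with `ψ 0 = 0` and Lipschitz constant at most `E₀`. -/
def HasLipschitzBoundary (r₀ E₀ : ℝ) (S : Set E3) : Prop :=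
  ∀ P ∈ frontier S, ∃ (φ : E3 ≃ᵢ E3) (ψ : E2 → ℝ),
    φ P = 0 ∧ ψ 0 = 0 ∧ LipschitzOnWith (Real.toNNReal E₀) ψ (Metric.ball 0 r₀) ∧
    (φ '' S) ∩ Metric.ball 0 r₀ = {x ∈ Metric.ball (0 : E3) r₀ | ψ (proj12 x) < x 2}

/-- `S` has boundary of class C³ with constants r₀, E₀. -/
def HasC3Boundary (r₀ E₀ : ℝ) (S : Set E3) : Prop :=
  ∀ P ∈ frontier S, ∃ (φ : E3 ≃ᵢ E3) (ψ : E2 → ℝ),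
    φ P = 0 ∧ ψ 0 = 0 ∧ ContDiff ℝ 3 ψ ∧ fderiv ℝ ψ 0 = 0 ∧
    (∀ x' ∈ Metric.ball (0 : E2) r₀, ∀ k : ℕ, k ≤ 3 → ‖iteratedFDeriv ℝ k ψ x'‖ ≤ E₀) ∧
    (φ '' S) ∩ Metric.ball 0 r₀ = {x ∈ Metric.ball (0 : E3) r₀ | ψ (proj12 x) < x 2}

/-- Geometric a priori assumptions on a cavity: bounded open set, closure inside the lower
half-space, connected complement in the half-space, contained in `B⁻_{2D₀}(0)`, at distance
at least `D₀` from the plane `{x₃ = 0}`, with diameter less than `D₀`. -/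
def IsCavity (D₀ : ℝ) (C : Set E3) : Prop :=
  IsOpen C ∧ Bornology.IsBounded C ∧ closure C ⊆ lowerHalf ∧
  IsConnected (lowerHalf \ closure C) ∧ C ⊆ negBall (2*D₀) ∧
  (∀ x ∈ C, x 2 ≤ -D₀) ∧ Metric.diam C < D₀

/-- Lipschitz cavity with parameters r₀, E₀, D₀. -/
def IsLipschitzCavity (r₀ E₀ D₀ : ℝ) (C : Set E3) : Prop :=
  IsCavity D₀ C ∧ HasLipschitzBoundary r₀ E₀ C

/-- C³ cavity with parameters r₀, E₀, D₀. -/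
def IsC3Cavity (r₀ E₀ D₀ : ℝ) (C : Set E3) : Prop :=
  IsCavity D₀ C ∧ HasC3Boundary r₀ E₀ C

/-! ### Proof -/

lemma frob2_nonneg (M : Matrix (Fin 3) (Fin 3) ℝ) : 0 ≤ frob2 M :=
  Finset.sum_nonneg fun _ _ => Finset.sum_nonneg fun _ _ => sq_nonneg _

lemma fderiv_bound (u : E3 → E3) (x w : E3) :
    ‖fderiv ℝ u x w‖ ^ 2 ≤ frob2 (jac u x) * ‖w‖ ^ 2 := by
  have hw : w = ∑ j, w j • (EuclideanSpace.single j (1 : ℝ) : E3) := by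
    ext i
    rw [Fin.sum_univ_three]
    fin_cases i <;> simp
  have h1 : ∀ i, (fderiv ℝ u x w) i = ∑ j, jac u x i j * w j := by
    intro i
    conv_lhs => rw [hw]
    simp [map_sum, jac, mul_comm]
  rw [EuclideanSpace.real_norm_sq_eq, EuclideanSpace.real_norm_sq_eq, frob2, Finset.sum_mul]
  refine Finset.sum_le_sum fun i _ => ?_
  rw [h1]
  exact Finset.sum_mul_sq_le_sq_mul_sq _ _ _

lemma sq_int_le (f : ℝ → ℝ) (hf : ContinuousOn f (Icc 0 1)) :
    (∫ t in (0:ℝ)..1, f t) ^ 2 ≤ ∫ t in (0:ℝ)..1, f t ^ 2 := by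
  set a := ∫ t in (0:ℝ)..1, f t with ha
  have i1 : IntervalIntegrable f volume 0 1 :=
    ContinuousOn.intervalIntegrable (by rwa [uIcc_of_le zero_le_one])
  have i2 : IntervalIntegrable (fun t => f t ^ 2) volume 0 1 :=
    ContinuousOn.intervalIntegrable (by rw [uIcc_of_le zero_le_one]; exact hf.pow 2)
  have h : ∫ t in (0:ℝ)..1, (2 * a * f t - a ^ 2) ≤ ∫ t in (0:ℝ)..1, f t ^ 2 := by
    apply intervalIntegral.integral_mono_on zero_le_one
      ((i1.const_mul _).sub intervalIntegrable_const) i2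
    intro t _
    nlinarith [sq_nonneg (f t - a)]
  rw [intervalIntegral.integral_sub (i1.const_mul _) intervalIntegrable_const,
    intervalIntegral.integral_const_mul, ← ha] at h
  simp at h
  nlinarith

def Uf (u : E3 → E3) (x : E3) : ENNReal := ENNReal.ofReal (‖u x‖ ^ 2)
def Gf (u : E3 → E3) (x : E3) : ENNReal := ENNReal.ofReal (frob2 (jac u x))

lemma jac_cont {Ω : Set E3} (hΩ : IsOpen Ω) {u : E3 → E3} (hu : ContDiffOn ℝ 1 u Ω) :
    ContinuousOn (fun x => frob2 (jac u x)) Ω := by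
  have h := hu.continuousOn_fderiv_of_isOpen hΩ le_rfl
  unfold frob2 jac
  refine continuousOn_finsetSum _ fun i _ => continuousOn_finsetSum _ fun j _ => ?_
  have h2 : ContinuousOn (fun x => fderiv ℝ u x (EuclideanSpace.single j 1)) Ω :=
    h.clm_apply continuousOn_const
  exact (((EuclideanSpace.proj (𝕜 := ℝ) i).continuous.comp_continuousOn h2)).pow 2

lemma pointwise {Ω : Set E3} (hΩ : IsOpen Ω) {u : E3 → E3} (hu : ContDiffOn ℝ 1 u Ω)
    (x w : E3) (hseg : ∀ t ∈ Icc (0:ℝ) 1, x + t • w ∈ Ω) :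
    Uf u x ≤ 2 * Uf u (x + w) +
      2 * ENNReal.ofReal (‖w‖ ^ 2) * ∫⁻ t in Icc (0:ℝ) 1, Gf u (x + t • w) := by
  have hline : Continuous (fun t : ℝ => x + t • w) := by fun_prop
  have hmaps : MapsTo (fun t : ℝ => x + t • w) (Icc 0 1) Ω := hseg
  have hg : ContinuousOn (fun t : ℝ => frob2 (jac u (x + t • w))) (Icc 0 1) :=
    (jac_cont hΩ hu).comp hline.continuousOn hmaps
  have hd : ∀ t ∈ Icc (0:ℝ) 1, HasDerivAt (fun t : ℝ => u (x + t • w))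
      (fderiv ℝ u (x + t • w) w) t := by
    intro t ht
    have h1 : HasDerivAt (fun t : ℝ => x + t • w) w t := by
      simpa using ((hasDerivAt_id t).smul_const w).const_add x
    have h2 : DifferentiableAt ℝ u (x + t • w) :=
      (hu.differentiableOn one_ne_zero).differentiableAt (hΩ.mem_nhds (hseg t ht))
    exact h2.hasFDerivAt.comp_hasDerivAt t h1
  have hc : ContinuousOn (fun t : ℝ => fderiv ℝ u (x + t • w) w) (Icc 0 1) :=
    ((hu.continuousOn_fderiv_of_isOpen hΩ le_rfl).comp hline.continuousOn hmaps).clm_apply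
      continuousOn_const
  have hftc := intervalIntegral.integral_eq_sub_of_hasDerivAt (a := (0:ℝ)) (b := 1)
    (f := fun t : ℝ => u (x + t • w)) (f' := fun t => fderiv ℝ u (x + t • w) w)
    (by rwa [uIcc_of_le zero_le_one])
    (ContinuousOn.intervalIntegrable (by rwa [uIcc_of_le zero_le_one]))
  simp only [one_smul, zero_smul, add_zero] at hftc
  have hn : ‖u (x + w) - u x‖ ≤ ∫ t in (0:ℝ)..1, ‖fderiv ℝ u (x + t • w) w‖ := by
    rw [← hftc]; exact intervalIntegral.norm_integral_le_integral_norm zero_le_one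
  have hn2 : ‖u (x + w) - u x‖ ^ 2 ≤ ‖w‖ ^ 2 * ∫ t in (0:ℝ)..1, frob2 (jac u (x + t • w)) := by
    calc _ ≤ (∫ t in (0:ℝ)..1, ‖fderiv ℝ u (x + t • w) w‖) ^ 2 := by gcongr
      _ ≤ ∫ t in (0:ℝ)..1, ‖fderiv ℝ u (x + t • w) w‖ ^ 2 := sq_int_le _ hc.norm
      _ ≤ ∫ t in (0:ℝ)..1, ‖w‖ ^ 2 * frob2 (jac u (x + t • w)) := by
          apply intervalIntegral.integral_mono_on zero_le_one
          · exact ContinuousOn.intervalIntegrable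
              (by rw [uIcc_of_le zero_le_one]; exact hc.norm.pow 2)
          · exact ContinuousOn.intervalIntegrable
              (by rw [uIcc_of_le zero_le_one]; exact continuousOn_const.mul hg)
          · intro t _
            rw [mul_comm]; exact fderiv_bound _ _ _
      _ = _ := intervalIntegral.integral_const_mul _ _
  have hG : ENNReal.ofReal (∫ t in (0:ℝ)..1, frob2 (jac u (x + t • w))) =
      ∫⁻ t in Icc (0:ℝ) 1, Gf u (x + t • w) := by
    rw [intervalIntegral.integral_of_le zero_le_one, ← integral_Icc_eq_integral_Ioc,
      ofReal_integral_eq_lintegral_ofReal]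
    · rfl
    · exact hg.integrableOn_Icc
    · exact Filter.Eventually.of_forall fun _ => frob2_nonneg _
  have hfin : ‖u x‖ ^ 2 ≤ 2 * ‖u (x + w)‖ ^ 2 + 2 * ‖w‖ ^ 2 *
      ∫ t in (0:ℝ)..1, frob2 (jac u (x + t • w)) := by
    have h3 : ‖u x‖ ≤ ‖u (x + w)‖ + ‖u (x + w) - u x‖ := by
      have := norm_sub_le (u (x + w)) (u (x + w) - u x)
      simpa using this
    have h4 : ‖u x‖ ^ 2 ≤ (‖u (x + w)‖ + ‖u (x + w) - u x‖) ^ 2 := by gcongr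
    nlinarith [sq_nonneg (‖u (x + w)‖ - ‖u (x + w) - u x‖)]
  have hI : 0 ≤ ∫ t in (0:ℝ)..1, frob2 (jac u (x + t • w)) :=
    intervalIntegral.integral_nonneg zero_le_one fun _ _ => frob2_nonneg _
  rw [← hG]
  unfold Uf
  refine (ENNReal.ofReal_le_ofReal hfin).trans (le_of_eq ?_)
  rw [ENNReal.ofReal_add (by positivity) (by positivity), ENNReal.ofReal_mul (by positivity),
    ENNReal.ofReal_mul (by positivity), ENNReal.ofReal_mul (by positivity)]
  simp

lemma lint_affine (f : E3 → ENNReal) (hf : Measurable f) (c : ℝ) (hc : 0 < c) (b : E3) :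
    ∫⁻ x, f (c • x + b) = ENNReal.ofReal ((c ^ 3)⁻¹) * ∫⁻ x, f x := by
  have h1 : ∫⁻ x, f (c • x + b) = ∫⁻ y, f (y + b) ∂(Measure.map (c • ·) (volume : Measure E3)) := by
    rw [lintegral_map (by fun_prop) (by fun_prop)]
  rw [h1, Measure.map_addHaar_smul _ hc.ne', lintegral_smul_measure, lintegral_add_right_eq_self]
  rw [abs_of_nonneg (by positivity)]
  simp

lemma meas_ind {B : Set E3} (hB : MeasurableSet B) {f : E3 → ℝ} (hf : ContinuousOn f B) :
    Measurable (B.indicator (fun x => ENNReal.ofReal (f x))) := by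
  classical
  have h1 : B.indicator (fun x => ENNReal.ofReal (f x)) =
      fun x => ENNReal.ofReal (B.piecewise f (fun _ => 0) x) := by
    ext x
    by_cases hx : x ∈ B <;> simp [hx]
  rw [h1]
  exact (hf.measurable_piecewise continuousOn_const hB).ennreal_ofReal

/-- Weighted homothety lemma. -/
lemma homothety {Ω : Set E3} (hΩ : IsOpen Ω) {u : E3 → E3} (hu : ContDiffOn ℝ 1 u Ω)
    (A : Set E3) (hA : MeasurableSet A) (W : E3 → ENNReal)
    (s : ℝ) (hs : 0 < s) (b : E3) (d κ : ℝ)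
    (hκ : ∀ t ∈ Icc (0:ℝ) 1, ((1 - t + t * s) ^ 3)⁻¹ ≤ κ)
    (hd : ∀ x ∈ A, W x * ENNReal.ofReal (‖(s - 1) • x + b‖ ^ 2) ≤ ENNReal.ofReal d)
    (hseg : ∀ x ∈ A, ∀ t ∈ Icc (0:ℝ) 1, x + t • ((s - 1) • x + b) ∈ Ω) :
    ∫⁻ x in A, W x * Uf u x ≤ 2 * (∫⁻ x in A, W x * Uf u (s • x + b)) +
      2 * ENNReal.ofReal d * ENNReal.ofReal κ * ∫⁻ x in Ω, Gf u x := by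
  set Gi : E3 → ENNReal := Ω.indicator (Gf u) with hGi
  have hGm : Measurable Gi := meas_ind hΩ.measurableSet (jac_cont hΩ hu)
  have hGint : ∫⁻ x, Gi x = ∫⁻ x in Ω, Gf u x := lintegral_indicator hΩ.measurableSet _
  have hjoint : Measurable (fun q : E3 × ℝ => Gi (q.1 + q.2 • ((s - 1) • q.1 + b))) :=
    hGm.comp (by fun_prop)
  have hinner : Measurable (fun x : E3 => ∫⁻ t in Icc (0:ℝ) 1, Gi (x + t • ((s - 1) • x + b))) :=
    hjoint.lintegral_prod_right'
  have hp : ∀ x ∈ A, W x * Uf u x ≤ 2 * (W x * Uf u (s • x + b)) +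
      2 * ENNReal.ofReal d * ∫⁻ t in Icc (0:ℝ) 1, Gi (x + t • ((s - 1) • x + b)) := by
    intro x hx
    have h1 := pointwise hΩ hu x ((s - 1) • x + b) (hseg x hx)
    have h2 : x + ((s - 1) • x + b) = s • x + b := by module
    rw [h2] at h1
    have h3 : ∫⁻ t in Icc (0:ℝ) 1, Gf u (x + t • ((s - 1) • x + b)) =
        ∫⁻ t in Icc (0:ℝ) 1, Gi (x + t • ((s - 1) • x + b)) := by
      apply setLIntegral_congr_fun measurableSet_Icc
      intro t ht
      simp only [Gi, indicator_of_mem (hseg x hx t ht)]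
    rw [h3] at h1
    calc W x * Uf u x ≤ _ := mul_le_mul' le_rfl h1
      _ = 2 * (W x * Uf u (s • x + b)) + 2 * (W x * ENNReal.ofReal (‖(s - 1) • x + b‖ ^ 2)) *
          ∫⁻ t in Icc (0:ℝ) 1, Gi (x + t • ((s - 1) • x + b)) := by ring
      _ ≤ _ := by gcongr; exact hd x hx
  calc ∫⁻ x in A, W x * Uf u x
      ≤ ∫⁻ x in A, (2 * (W x * Uf u (s • x + b)) +
      2 * ENNReal.ofReal d * ∫⁻ t in Icc (0:ℝ) 1, Gi (x + t • ((s - 1) • x + b))) :=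
        setLIntegral_mono' hA hp
    _ = 2 * (∫⁻ x in A, W x * Uf u (s • x + b)) + 2 * ENNReal.ofReal d *
        ∫⁻ x in A, ∫⁻ t in Icc (0:ℝ) 1, Gi (x + t • ((s - 1) • x + b)) := by
        rw [lintegral_add_right _ (hinner.const_mul _), lintegral_const_mul _ hinner,
          lintegral_const_mul' _ _ (by simp)]
    _ ≤ 2 * (∫⁻ x in A, W x * Uf u (s • x + b)) + 2 * ENNReal.ofReal d *
        (ENNReal.ofReal κ * ∫⁻ x, Gi x) := by
        gcongr
        calc ∫⁻ x in A, ∫⁻ t in Icc (0:ℝ) 1, Gi (x + t • ((s - 1) • x + b))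
            ≤ ∫⁻ x, ∫⁻ t in Icc (0:ℝ) 1, Gi (x + t • ((s - 1) • x + b)) :=
              setLIntegral_le_lintegral _ _
          _ = ∫⁻ t in Icc (0:ℝ) 1, ∫⁻ x, Gi (x + t • ((s - 1) • x + b)) :=
              lintegral_lintegral_swap hjoint.aemeasurable
          _ ≤ ∫⁻ t in Icc (0:ℝ) 1, ENNReal.ofReal κ * ∫⁻ x, Gi x := by
              apply setLIntegral_mono' measurableSet_Icc
              intro t ht
              have hpos : 0 < 1 - t + t * s := by
                rcases eq_or_lt_of_le ht.2 with h | h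
                · rw [h]; linarith
                · nlinarith [ht.1, mul_nonneg ht.1 hs.le]
              have : ∀ x : E3, x + t • ((s - 1) • x + b) = (1 - t + t * s) • x + t • b := by
                intro x; module
              simp_rw [this]
              rw [lint_affine Gi hGm _ hpos]
              gcongr
              exact hκ t ht
          _ = ENNReal.ofReal κ * ∫⁻ x, Gi x := by simp
    _ = _ := by rw [hGint]; ring
lemma hom1 {Ω : Set E3} (hΩ : IsOpen Ω) {u : E3 → E3} (hu : ContDiffOn ℝ 1 u Ω)
    (A : Set E3) (hA : MeasurableSet A) (B : Set E3) (hB : MeasurableSet B) (hBΩ : B ⊆ Ω)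
    (s : ℝ) (hs : 0 < s) (hs1 : s ≤ 1) (b : E3) (D K : ℝ)
    (hK1 : 2 * (s ^ 3)⁻¹ ≤ K) (hK2 : 2 * D ^ 2 * (s ^ 3)⁻¹ ≤ K)
    (hd : ∀ x ∈ A, ‖(s - 1) • x + b‖ ≤ D)
    (hseg : ∀ x ∈ A, ∀ t ∈ Icc (0:ℝ) 1, x + t • ((s - 1) • x + b) ∈ Ω)
    (hAB : ∀ x ∈ A, s • x + b ∈ B) :
    ∫⁻ x in A, Uf u x ≤ ENNReal.ofReal K * ((∫⁻ x in B, Uf u x) + ∫⁻ x in Ω, Gf u x) := by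
  have h := homothety hΩ hu A hA (fun _ => 1) s hs b (D ^ 2) ((s ^ 3)⁻¹)
    (by
      intro t ht
      have : s ≤ 1 - t + t * s := by nlinarith [ht.1, ht.2]
      gcongr)
    (by
      intro x hx
      rw [one_mul]
      have := hd x hx
      gcongr) hseg
  simp only [one_mul] at h
  have hm : Measurable (B.indicator (Uf u)) :=
    meas_ind hB ((hu.continuousOn.mono hBΩ).norm.pow 2)
  have h2 : ∫⁻ x in A, Uf u (s • x + b) ≤ ENNReal.ofReal ((s ^ 3)⁻¹) * ∫⁻ x in B, Uf u x := by
    rw [← lintegral_indicator hB, ← lint_affine _ hm s hs b]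
    refine le_trans ?_ (setLIntegral_le_lintegral A _)
    apply setLIntegral_mono' hA
    intro x hx
    rw [indicator_of_mem (hAB x hx)]
  refine h.trans ?_
  rw [mul_add]
  refine add_le_add ?_ ?_
  · calc _ ≤ 2 * (ENNReal.ofReal ((s ^ 3)⁻¹) * ∫⁻ x in B, Uf u x) := mul_le_mul' le_rfl h2
      _ = ENNReal.ofReal (2 * (s ^ 3)⁻¹) * ∫⁻ x in B, Uf u x := by
        rw [← mul_assoc, ENNReal.ofReal_mul zero_le_two, ENNReal.ofReal_ofNat]
      _ ≤ _ := mul_le_mul' (ENNReal.ofReal_le_ofReal hK1) le_rfl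
  · refine mul_le_mul' ((le_of_eq ?_).trans (ENNReal.ofReal_le_ofReal hK2)) le_rfl
    rw [ENNReal.ofReal_mul (by positivity), ENNReal.ofReal_mul zero_le_two,
      ENNReal.ofReal_ofNat]

def Wt (x : E3) : ENNReal := ENNReal.ofReal (1 / (1 + ‖x‖ ^ 2))

lemma Wt_cont : Continuous (fun x : E3 => 1 / (1 + ‖x‖ ^ 2)) := by
  refine continuous_const.div (by fun_prop) fun x => by positivity

def farSet (R : ℝ) : Set E3 := {x | x 2 < 0 ∧ R < ‖x‖}

lemma coord_cont (i : Fin 3) : Continuous (fun x : E3 => x i) :=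
  (EuclideanSpace.proj (𝕜 := ℝ) i).continuous

lemma farSet_open (R : ℝ) : IsOpen (farSet R) :=
  (isOpen_lt (coord_cont 2) continuous_const).inter
    (isOpen_lt continuous_const continuous_norm)

lemma hardy {Ω : Set E3} (hΩ : IsOpen Ω) {u : E3 → E3} (hu : ContDiffOn ℝ 1 u Ω)
    (R : ℝ) (hR : 0 ≤ R) (hsub : farSet R ⊆ Ω)
    (hfin : ∫⁻ x in farSet R, Wt x * Uf u x ≠ ⊤) :
    ∫⁻ x in farSet R, Wt x * Uf u x ≤ 36 * ∫⁻ x in Ω, Gf u x := by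
  have hAm := (farSet_open R).measurableSet
  have hmem : ∀ x ∈ farSet R, ∀ c : ℝ, 1 ≤ c → c • x ∈ farSet R := by
    intro x hx c hc
    refine ⟨?_, ?_⟩
    · have := hx.1
      simp only [PiLp.smul_apply, smul_eq_mul]
      nlinarith
    · have := hx.2
      rw [norm_smul, Real.norm_of_nonneg (by linarith)]
      nlinarith [norm_nonneg x]
  have h := homothety hΩ hu (farSet R) hAm Wt 4 (by norm_num)
    0 9 1 ?_ ?_ ?_
  · have hm : Measurable ((farSet R).indicator (fun x => Wt x * Uf u x)) := by
      have : (fun x => Wt x * Uf u x) =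
          fun x => ENNReal.ofReal (1 / (1 + ‖x‖ ^ 2) * ‖u x‖ ^ 2) := by
        ext x
        rw [ENNReal.ofReal_mul (by positivity)]; rfl
      rw [this]
      exact meas_ind hAm (Wt_cont.continuousOn.mul ((hu.continuousOn.mono hsub).norm.pow 2))
    have h2 : ∫⁻ x in farSet R, Wt x * Uf u ((4:ℝ) • x + 0) ≤
        4⁻¹ * ∫⁻ x in farSet R, Wt x * Uf u x := by
      have h3 := lint_affine _ hm 4 (by norm_num) 0
      rw [lintegral_indicator hAm] at h3
      calc _ ≤ ∫⁻ x in farSet R, 16 * (farSet R).indicator (fun x => Wt x * Uf u x)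
              ((4:ℝ) • x + 0) := by
            apply setLIntegral_mono' hAm
            intro x hx
            have h4 : (4:ℝ) • x + 0 ∈ farSet R := by
              rw [add_zero]; exact hmem x hx 4 (by norm_num)
            rw [indicator_of_mem h4, ← mul_assoc]
            gcongr
            rw [show (16 : ENNReal) = ENNReal.ofReal 16 by simp, Wt, Wt,
              ← ENNReal.ofReal_mul (by norm_num)]
            gcongr
            rw [add_zero, norm_smul, Real.norm_of_nonneg (by norm_num), mul_one_div,
              div_le_div_iff₀ (by positivity) (by positivity)]
            nlinarith [sq_nonneg ‖x‖]
        _ ≤ ∫⁻ x, 16 * (farSet R).indicator (fun x => Wt x * Uf u x) ((4:ℝ) • x + 0) :=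
            setLIntegral_le_lintegral _ _
        _ = 16 * (ENNReal.ofReal ((4 ^ 3)⁻¹) * ∫⁻ x in farSet R, Wt x * Uf u x) := by
            rw [← h3, lintegral_const_mul' _ _ (by simp)]
        _ = _ := by
            rw [← mul_assoc]
            congr 1
            rw [show (16 : ENNReal) = ENNReal.ofReal 16 by simp,
              ← ENNReal.ofReal_mul (by norm_num),
              show (4⁻¹ : ENNReal) = ENNReal.ofReal 4⁻¹ by
                rw [ENNReal.ofReal_inv_of_pos (by norm_num)]; simp]
            norm_num
    set J := ∫⁻ x in farSet R, Wt x * Uf u x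
    set G := ∫⁻ x in Ω, Gf u x
    have h5 : J ≤ 2 * (4⁻¹ * J) + 18 * G := by
      refine h.trans ?_
      gcongr
      rw [show (9:ℝ) = ((9:ℕ):ℝ) by norm_num, ENNReal.ofReal_natCast]
      simp
      norm_num
    clear_value J G
    by_cases hG : G = ⊤
    · rw [hG]; simp
    · lift J to NNReal using hfin
      lift G to NNReal using hG
      have h6 : (J : ℝ) ≤ 2 * (4⁻¹ * J) + 18 * G := by
        rw [show (4⁻¹ : ENNReal) = ((4⁻¹ : NNReal) : ENNReal) by simp] at h5
        exact_mod_cast h5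
      have h7 : (J : ℝ) ≤ 36 * G := by linarith
      exact_mod_cast h7
  · intro t ht
    apply inv_le_one_of_one_le₀
    apply one_le_pow₀
    linarith [ht.1]
  · intro x _
    rw [Wt, ← ENNReal.ofReal_mul (by positivity)]
    gcongr
    rw [add_zero, norm_smul, Real.norm_of_nonneg (by norm_num), one_div, inv_mul_le_iff₀ (by positivity)]
    nlinarith [sq_nonneg ‖x‖]
  · intro x hx t ht
    apply hsub
    have : x + t • ((4 - 1 : ℝ) • x + 0) = (1 + 3 * t) • x := by module
    rw [this]
    exact hmem x hx _ (by linarith [ht.1])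
lemma proj12_norm_le (v : E3) : ‖proj12 v‖ ≤ ‖v‖ := by
  apply le_of_sq_le_sq _ (norm_nonneg v)
  rw [EuclideanSpace.real_norm_sq_eq, EuclideanSpace.real_norm_sq_eq, Fin.sum_univ_two,
    Fin.sum_univ_three]
  simp [proj12]
  positivity

lemma proj12_sub (v w : E3) : proj12 v - proj12 w = proj12 (v - w) := by
  simp only [proj12, PiLp.sub_apply]
  module

lemma abs_coord_le (v : E3) (i : Fin 3) : |v i| ≤ ‖v‖ := by
  simpa using PiLp.norm_apply_le v i

lemma cone {r₀ E₀ D₀ : ℝ} (hE₀ : 0 < E₀) (hD₀ : 1 < D₀) {C : Set E3}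
    (hC : ∀ x ∈ C, x 2 ≤ -D₀) (hL : HasLipschitzBoundary r₀ E₀ C) (P : E3) (hP : P ∈ frontier C)
    (r θ : ℝ) (hr0 : r ≤ r₀) (hr1 : r ≤ 1) (hθ : θ = 1 / (2 * (1 + E₀))) :
    ∃ n : E3, ‖n‖ = 1 ∧ ∀ x ∈ lowerHalf \ closure C, x ∈ ball P r → ∀ h : ℝ, 0 ≤ h → ∀ z : E3,
      ‖z‖ ≤ θ * h → x + h • n + z ∈ ball P r → x + h • n + z ∈ lowerHalf \ closure C := by
  obtain ⟨φ, ψ, hφP, -, hψ, hset⟩ := hL P hP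
  set f := φ.toRealAffineIsometryEquiv with hf
  have hfφ : ∀ x, f x = φ x := fun x => rfl
  set Li := f.linearIsometryEquiv with hLi
  have hadd : ∀ x w, φ (x + w) = Li w + φ x := by
    intro x w
    have := f.map_vadd x w
    simpa [hfφ, add_comm] using this
  set e : E3 := EuclideanSpace.single 2 1 with he
  have hball : ∀ x, x ∈ ball P r → φ x ∈ ball (0 : E3) r₀ := by
    intro x hx
    rw [mem_ball, ← hφP, φ.dist_eq]
    exact (mem_ball.1 hx).trans_le hr0
  have hiff : ∀ x, x ∈ ball P r → (x ∈ C ↔ ψ (proj12 (φ x)) < φ x 2) := by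
    intro x hx
    have h1 : φ x ∈ (φ '' C) ∩ ball 0 r₀ ↔ φ x ∈ {x ∈ ball (0 : E3) r₀ | ψ (proj12 x) < x 2} := by
      rw [hset]
    simpa [hball x hx, φ.injective.mem_set_image, mem_ball_zero_iff.1 (hball x hx)] using h1
  have hpos : 0 < 1 + E₀ := by linarith
  have hθpos : 0 < θ := by rw [hθ]; positivity
  have key : ∀ x ∈ ball P r, x ∉ C → ∀ h : ℝ, 0 < h → ∀ z : E3, ‖z‖ ≤ 2 * θ * h →
      x + h • Li.symm (-e) + z ∈ ball P r → x + h • Li.symm (-e) + z ∉ C := by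
    intro x hx hxC h hh z hz hy hyC
    rw [hiff _ hx] at hxC
    rw [hiff _ hy] at hyC
    have hφy : φ (x + h • Li.symm (-e) + z) = φ x - h • e + Li z := by
      rw [add_assoc, hadd, map_add, map_smul, Li.apply_symm_apply]
      module
    have hlip := hψ.dist_le_mul (proj12 (φ x))
      (mem_ball_zero_iff.2 ((proj12_norm_le _).trans_lt (mem_ball_zero_iff.1 (hball _ hx))))
      (proj12 (φ (x + h • Li.symm (-e) + z)))
      (mem_ball_zero_iff.2 ((proj12_norm_le _).trans_lt (mem_ball_zero_iff.1 (hball _ hy))))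
    rw [Real.coe_toNNReal _ hE₀.le, Real.dist_eq, dist_eq_norm, proj12_sub] at hlip
    have hpe : proj12 (φ x - φ (x + h • Li.symm (-e) + z)) = proj12 (-(Li z)) := by
      rw [hφy]
      simp [proj12, he]
    have h2 : ‖proj12 (φ x - φ (x + h • Li.symm (-e) + z))‖ ≤ ‖z‖ := by
      rw [hpe]
      refine (proj12_norm_le _).trans (le_of_eq ?_)
      rw [norm_neg, Li.norm_map]
    have h3 : φ (x + h • Li.symm (-e) + z) 2 = φ x 2 - h + (Li z) 2 := by
      rw [hφy]
      simp [he]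
    have h4 : (Li z) 2 ≤ ‖z‖ := by
      rw [← Li.norm_map z]
      exact (le_abs_self _).trans (abs_coord_le _ _)
    have h5 := (abs_le.1 hlip).2
    have h6 : E₀ * ‖proj12 (φ x - φ (x + h • Li.symm (-e) + z))‖ ≤ E₀ * ‖z‖ := by gcongr
    have h7 : (1 + E₀) * ‖z‖ ≤ h := by
      calc (1 + E₀) * ‖z‖ ≤ (1 + E₀) * (2 * θ * h) := by gcongr
        _ = h := by rw [hθ]; field_simp
    rw [not_lt] at hxC
    linarith
  have hclos : closure C ⊆ {x | x 2 ≤ -D₀} :=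
    closure_minimal hC (isClosed_le (coord_cont 2) continuous_const)
  have hhalf : ∀ y ∈ ball P r, y ∈ lowerHalf := by
    intro y hy
    have h1 : P 2 ≤ -D₀ := hclos (frontier_subset_closure hP)
    have h2 : (y - P) 2 ≤ ‖y - P‖ := (le_abs_self _).trans (abs_coord_le _ _)
    rw [mem_ball, dist_eq_norm] at hy
    simp only [PiLp.sub_apply] at h2
    change y 2 < 0
    linarith
  refine ⟨Li.symm (-e), by rw [Li.symm.norm_map, norm_neg, he]; simp, ?_⟩
  intro x hx hxP h hh z hz hy
  rcases hh.eq_or_lt with h0 | h0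
  · have : z = 0 := by
      rw [← h0, mul_zero] at hz
      exact norm_le_zero_iff.1 hz
    rw [this, ← h0]
    simpa using hx
  refine ⟨hhalf _ hy, ?_⟩
  intro hcl
  rw [Metric.mem_closure_iff] at hcl
  obtain ⟨b, hbC, hb⟩ := hcl (min (θ * h) (r - dist (x + h • Li.symm (-e) + z) P))
    (lt_min (by positivity) (by rw [mem_ball] at hy; linarith))
  set y := x + h • Li.symm (-e) + z with hydef
  have hb' : b = x + h • Li.symm (-e) + (z + (b - y)) := by rw [hydef]; abel
  have hb1 := hb.trans_le (min_le_left _ _)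
  have hb2 := hb.trans_le (min_le_right _ _)
  have hbP : b ∈ ball P r := by
    rw [mem_ball]
    have := dist_triangle b y P
    rw [dist_comm b y] at this
    linarith
  refine key x hxP (fun hh => hx.2 (subset_closure hh)) h h0 (z + (b - y)) ?_ ?_ ?_
  · have := norm_add_le z (b - y)
    rw [dist_comm, dist_eq_norm] at hb1
    linarith
  · rw [← hb']; exact hbP
  · rw [← hb']; exact hbC

lemma local_step {Ω : Set E3} (hΩ : IsOpen Ω) {u : E3 → E3} (hu : ContDiffOn ℝ 1 u Ω)
    (P n : E3) (hn : ‖n‖ = 1) (r θ σ : ℝ) (hr1 : r ≤ 1) (hθ : 0 < θ) (hθ2 : θ ≤ 1 / 2)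
    (hσ : 0 < σ) (hσr : 10 * σ = θ * r)
    (hcone : ∀ x ∈ Ω, x ∈ ball P r → ∀ h : ℝ, 0 ≤ h → ∀ z : E3,
      ‖z‖ ≤ θ * h → x + h • n + z ∈ ball P r → x + h • n + z ∈ Ω)
    (p q : E3) (hq : q ∈ Ω) (hpq : dist q p < σ) (hpP : dist p P < σ) (K : ℝ)
    (hK : K = 2 * ((θ / 4) ^ 3)⁻¹) :
    ∫⁻ x in Ω ∩ ball p σ, Uf u x ≤ ENNReal.ofReal K * (ENNReal.ofReal K *
      ((∫⁻ x in Ω ∩ ball q σ, Uf u x) + ∫⁻ x in Ω, Gf u x) + ∫⁻ x in Ω, Gf u x) := by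
  set H := r / 5 with hH
  have hr : 0 < r := by
    by_contra hcon
    nlinarith
  have hθH : θ * H = 2 * σ := by rw [hH]; linarith
  have hσr2 : 20 * σ ≤ r := by nlinarith
  have hs : 0 < θ / 4 := by positivity
  have hK2 : 2 ≤ K := by
    rw [hK]
    have : 1 ≤ ((θ / 4) ^ 3)⁻¹ := by
      apply (one_le_inv₀ (by positivity)).2
      apply pow_le_one₀ <;> linarith
    linarith
  have hqP : dist q P < 2 * σ := by linarith [dist_triangle q p P]
  have hqB : q ∈ ball P r := by rw [mem_ball]; linarith
  have hin : ∀ x : E3, ∀ h : ℝ, 0 ≤ h → h ≤ H → dist x P < 2 * σ → ∀ z : E3, ‖z‖ ≤ 2 * σ →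
      x + h • n + z ∈ ball P r := by
    intro x h h0 hh hx z hz
    rw [mem_ball, dist_eq_norm]
    have e1 : x + h • n + z - P = (x - P) + h • n + z := by abel
    have e2 := norm_add₃_le (a := x - P) (b := h • n) (c := z)
    rw [norm_smul, hn, Real.norm_of_nonneg h0] at e2
    rw [e1]
    rw [dist_eq_norm] at hx
    have : H = r / 5 := hH
    linarith
  have hbΩ : ball (q + H • n) (θ * σ / 2) ⊆ Ω := by
    intro y hy
    rw [mem_ball, dist_eq_norm] at hy
    have e1 : y = q + H • n + (y - (q + H • n)) := by abel
    rw [e1]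
    refine hcone q hq hqB H (by positivity) _ ?_ ?_
    · nlinarith
    · refine hin q H (by positivity) le_rfl hqP _ ?_
      nlinarith
  have s1 : ∫⁻ x in Ω ∩ ball p σ, Uf u x ≤ ENNReal.ofReal K *
      ((∫⁻ x in ball (q + H • n) (θ * σ / 2), Uf u x) + ∫⁻ x in Ω, Gf u x) := by
    have hxq : ∀ x ∈ ball p σ, ‖x - q‖ < 2 * σ := by
      intro x hx
      rw [← dist_eq_norm]
      rw [mem_ball] at hx
      rw [dist_comm q p] at hpq
      linarith [dist_triangle x p q]
    have hw : ∀ x : E3, (θ / 4 - 1) • x + (q + H • n - (θ / 4) • q) =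
        H • n + (-(1 - θ / 4)) • (x - q) := by intro x; module
    have hnw : ∀ x ∈ ball p σ, ‖(-(1 - θ / 4)) • (x - q)‖ ≤ 2 * σ := by
      intro x hx
      rw [norm_smul, norm_neg, Real.norm_of_nonneg (by linarith)]
      nlinarith [hxq x hx, norm_nonneg (x - q)]
    refine hom1 hΩ hu _ (hΩ.inter isOpen_ball).measurableSet _ isOpen_ball.measurableSet hbΩ
      (θ / 4) hs (by linarith) (q + H • n - (θ / 4) • q) 1 K (by rw [hK]) (by rw [hK]; simp)
      ?_ ?_ ?_
    · rintro x ⟨_, hx⟩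
      rw [hw]
      have e2 := norm_add_le (H • n) ((-(1 - θ / 4)) • (x - q))
      rw [norm_smul H n, hn, Real.norm_of_nonneg (by positivity)] at e2
      have := hnw x hx
      have : H = r / 5 := hH
      linarith
    · rintro x ⟨hxΩ, hx⟩ t ht
      have hxP : dist x P < 2 * σ := by
        rw [mem_ball] at hx
        linarith [dist_triangle x p P]
      rw [hw]
      have e1 : x + t • (H • n + (-(1 - θ / 4)) • (x - q)) =
          x + (t * H) • n + t • ((-(1 - θ / 4)) • (x - q)) := by module
      have e2 : ‖t • ((-(1 - θ / 4)) • (x - q))‖ ≤ t * (2 * σ) := by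
        rw [norm_smul, Real.norm_of_nonneg ht.1]
        exact mul_le_mul_of_nonneg_left (hnw x hx) ht.1
      have hH0 : 0 < H := by positivity
      rw [e1]
      refine hcone x hxΩ (by rw [mem_ball]; linarith) _ (mul_nonneg ht.1 hH0.le) _ ?_ ?_
      · rw [← hθH] at e2; linarith
      · refine hin x _ (mul_nonneg ht.1 hH0.le) ?_ hxP _ ?_
        · nlinarith [ht.2]
        · nlinarith [ht.2]
    · rintro x ⟨_, hx⟩
      rw [mem_ball, dist_eq_norm]
      have e1 : (θ / 4) • x + (q + H • n - (θ / 4) • q) - (q + H • n) = (θ / 4) • (x - q) := by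
        module
      rw [e1, norm_smul, Real.norm_of_nonneg hs.le]
      nlinarith [hxq x hx]
  have s2 : ∫⁻ x in ball (q + H • n) (θ * σ / 2), Uf u x ≤ ENNReal.ofReal K *
      ((∫⁻ x in Ω ∩ ball q σ, Uf u x) + ∫⁻ x in Ω, Gf u x) := by
    have hcH : 0 ≤ H - σ / 2 := by rw [hH]; linarith
    have hgen : ∀ x ∈ ball (q + H • n) (θ * σ / 2), ∀ t ∈ Icc (0:ℝ) 1,
        x + t • (((1:ℝ) - 1) • x + (σ / 2 - H) • n) ∈ Ω := by
      intro x hx t ht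
      rw [mem_ball, dist_eq_norm] at hx
      have e1 : x + t • (((1:ℝ) - 1) • x + (σ / 2 - H) • n) =
          q + (H - t * (H - σ / 2)) • n + (x - (q + H • n)) := by module
      have hh : σ / 2 ≤ H - t * (H - σ / 2) := by nlinarith [ht.2]
      rw [e1]
      refine hcone q hq hqB _ (by linarith) _ ?_ ?_
      · nlinarith
      · refine hin q _ (by linarith) ?_ hqP _ ?_
        · nlinarith [ht.1, mul_nonneg ht.1 hcH]
        · nlinarith
    refine hom1 hΩ hu _ isOpen_ball.measurableSet _ (hΩ.inter isOpen_ball).measurableSet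
      inter_subset_left 1 one_pos le_rfl ((σ / 2 - H) • n) 1 K (by simpa using hK2)
      (by simpa using hK2) ?_ hgen ?_
    · intro x _
      rw [sub_self, zero_smul, zero_add, norm_smul, hn, mul_one, Real.norm_eq_abs, abs_sub_comm,
        abs_of_nonneg hcH]
      have : H = r / 5 := hH
      linarith
    · intro x hx
      refine ⟨?_, ?_⟩
      · have := hgen x hx 1 ⟨zero_le_one, le_rfl⟩
        simpa using this
      · rw [mem_ball, dist_eq_norm] at hx ⊢
        have e1 : (1:ℝ) • x + (σ / 2 - H) • n - q = (σ / 2) • n + (x - (q + H • n)) := by module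
        rw [e1]
        have e2 := norm_add_le ((σ / 2) • n) (x - (q + H • n))
        rw [norm_smul, hn, Real.norm_of_nonneg (by positivity)] at e2
        nlinarith
  exact s1.trans (mul_le_mul' le_rfl (add_le_add s2 le_rfl))
lemma inter_frontier_ne {B S : Set E3} (hB : IsPreconnected B) (hS : IsClosed S)
    (h1 : (B ∩ S).Nonempty) (h2 : (B ∩ Sᶜ).Nonempty) : (B ∩ frontier S).Nonempty := by
  by_contra hcon
  have hi : ∀ x ∈ B, x ∈ S → x ∈ interior S := by
    intro x hx hxS
    by_contra hxi
    exact hcon ⟨x, hx, by rw [hS.frontier_eq]; exact ⟨hxS, hxi⟩⟩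
  obtain ⟨y, hyB, hyS⟩ := h1
  obtain ⟨x, -, hx1, hx2⟩ := hB (interior S) Sᶜ isOpen_interior hS.isOpen_compl
    (fun x hx => by
      by_cases hxS : x ∈ S
      · exact Or.inl (hi x hx hxS)
      · exact Or.inr hxS)
    ⟨y, hyB, hi y hyB hyS⟩ h2
  exact hx2 (interior_subset hx1)

lemma step {r₀ E₀ D₀ : ℝ} (hr₀ : 0 < r₀) (hE₀ : 0 < E₀) (hD₀ : 1 < D₀) {C : Set E3}
    (hC : ∀ x ∈ C, x 2 ≤ -D₀) (hL : HasLipschitzBoundary r₀ E₀ C)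
    (r θ σ K : ℝ) (hr : r = min r₀ 1) (hθ : θ = 1 / (2 * (1 + E₀))) (hσ : σ = θ * r / 10)
    (hK : K = 2 * ((θ / 4) ^ 3)⁻¹)
    {Ω : Set E3} (hΩe : Ω = lowerHalf \ closure C)
    (hΩ : IsOpen Ω) {u : E3 → E3} (hu : ContDiffOn ℝ 1 u Ω)
    (p q : E3) (hp : p ∈ Ω) (hq : q ∈ Ω) (hpq : dist q p < σ) :
    ∫⁻ x in Ω ∩ ball p σ, Uf u x ≤ ENNReal.ofReal K * (ENNReal.ofReal K *
      ((∫⁻ x in Ω ∩ ball q σ, Uf u x) + ∫⁻ x in Ω, Gf u x) + ∫⁻ x in Ω, Gf u x) := by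
  have hrpos : 0 < r := by rw [hr]; exact lt_min hr₀ one_pos
  have hr1 : r ≤ 1 := by rw [hr]; exact min_le_right _ _
  have hθpos : 0 < θ := by rw [hθ]; positivity
  have hθ2 : θ ≤ 1 / 2 := by
    rw [hθ]
    apply one_div_le_one_div_of_le <;> linarith
  have hσpos : 0 < σ := by rw [hσ]; positivity
  have hσ1 : 20 * σ ≤ 1 := by rw [hσ]; nlinarith
  have hs : 0 < θ / 4 := by positivity
  have hK16 : 16 ≤ K := by
    have h1 : (8:ℝ) ≤ (θ / 4)⁻¹ := by
      rw [le_inv_comm₀ (by norm_num) hs]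
      linarith
    have h2 : (8:ℝ) ^ 3 ≤ ((θ / 4)⁻¹) ^ 3 := by gcongr
    rw [inv_pow] at h2
    rw [hK]
    linarith
  by_cases hcase : (ball p σ ∩ closure C).Nonempty
  · obtain ⟨P, hPb, hPf⟩ := inter_frontier_ne ((convex_ball p σ).isPreconnected) isClosed_closure
      hcase ⟨p, mem_ball_self hσpos, by rw [hΩe] at hp; exact hp.2⟩
    obtain ⟨n, hn, hcone⟩ := cone hE₀ hD₀ hC hL P (frontier_closure_subset hPf) r θ
      (by rw [hr]; exact min_le_left _ _) hr1 hθ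
    rw [← hΩe] at hcone
    exact local_step hΩ hu P n hn r θ σ hr1 hθpos hθ2 hσpos (by rw [hσ]; ring) hcone p q hq hpq
      (by rw [dist_comm]; exact hPb) K hK
  · have hsub : lowerHalf ∩ ball p σ ⊆ Ω := by
      rintro x ⟨h1, h2⟩
      rw [hΩe]
      exact ⟨h1, fun h3 => hcase ⟨x, h2, h3⟩⟩
    have hqb : q ∈ ball p σ := hpq
    have hΩh : Ω ⊆ lowerHalf := by rw [hΩe]; exact sdiff_subset
    have hgen : ∀ x ∈ Ω ∩ ball p σ, ∀ t ∈ Icc (0:ℝ) 1,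
        x + t • (((1:ℝ) / 2 - 1) • x + (1 / 2 : ℝ) • q) ∈ Ω := by
      rintro x ⟨hx1, hx2⟩ t ht
      have e1 : x + t • (((1:ℝ) / 2 - 1) • x + (1 / 2 : ℝ) • q) = (1 - t / 2) • x + (t / 2) • q := by
        module
      rw [e1]
      apply hsub
      refine ⟨?_, convex_ball p σ hx2 hqb (by linarith [ht.2]) (by linarith [ht.1]) (by ring)⟩
      have a1 : x 2 < 0 := hΩh hx1
      have a2 : q 2 < 0 := hΩh hq
      change ((1 - t / 2) • x + (t / 2) • q) 2 < 0
      simp only [PiLp.add_apply, PiLp.smul_apply, smul_eq_mul]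
      nlinarith [ht.1, ht.2]
    have hxq : ∀ x ∈ ball p σ, ‖q - x‖ < 2 * σ := by
      intro x hx
      rw [← dist_eq_norm]
      rw [mem_ball, dist_comm] at hx
      linarith [dist_triangle q p x]
    have h := hom1 hΩ hu (Ω ∩ ball p σ) (hΩ.inter isOpen_ball).measurableSet (Ω ∩ ball q σ)
      (hΩ.inter isOpen_ball).measurableSet inter_subset_left (1 / 2) (by norm_num) (by norm_num)
      ((1 / 2 : ℝ) • q) 1 K (by norm_num; linarith) (by norm_num; linarith) ?_ hgen ?_
    · refine h.trans (mul_le_mul' le_rfl ?_)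
      refine le_trans ?_ le_self_add
      exact le_mul_of_one_le_left (by positivity) (by rw [ENNReal.one_le_ofReal]; linarith)
    · rintro x ⟨_, hx⟩
      have e1 : ((1:ℝ) / 2 - 1) • x + (1 / 2 : ℝ) • q = (1 / 2 : ℝ) • (q - x) := by module
      rw [e1, norm_smul, Real.norm_of_nonneg (by norm_num)]
      linarith [hxq x hx]
    · rintro x hx
      refine ⟨?_, ?_⟩
      · have e1 : x + (1:ℝ) • (((1:ℝ) / 2 - 1) • x + (1 / 2 : ℝ) • q) =
          (1 / 2 : ℝ) • x + (1 / 2 : ℝ) • q := by module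
        rw [← e1]
        exact hgen x hx 1 ⟨zero_le_one, le_rfl⟩
      · have e1 : (1 / 2 : ℝ) • x + (1 / 2 : ℝ) • q - q = (-(1 / 2 : ℝ)) • (q - x) := by module
        rw [mem_ball, dist_eq_norm, e1, norm_smul, norm_neg, Real.norm_of_nonneg (by norm_num)]
        linarith [hxq x hx.2]

lemma chain {ι : Type*} [Fintype ι] {Ω : Set E3} (hconn : IsPreconnected Ω) (V : ι → Set E3)
    (hV : ∀ i, IsOpen (V i)) (hcov : Ω ⊆ ⋃ i, V i) (Q : ℕ → ι → Prop)
    (hmono : ∀ n i, Q n i → Q (n + 1) i) (i0 : ι) (hi0 : (Ω ∩ V i0).Nonempty) (hQ0 : Q 0 i0)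
    (hstep : ∀ n i j, (Ω ∩ (V i ∩ V j)).Nonempty → Q n i → Q (n + 1) j) :
    ∀ i, (Ω ∩ V i).Nonempty → Q (Fintype.card ι) i := by
  classical
  have claim : ∀ k : ℕ, ∃ s : Finset ι, i0 ∈ s ∧ (∀ i ∈ s, Q k i) ∧
      ((∀ i, (Ω ∩ V i).Nonempty → i ∈ s) ∨ k + 1 ≤ s.card) := by
    intro k
    induction k with
    | zero => exact ⟨{i0}, by simp, by simpa using hQ0, Or.inr (by simp)⟩
    | succ k ih =>
      obtain ⟨s, h0, hs, hor⟩ := ih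
      by_cases hall : ∀ i, (Ω ∩ V i).Nonempty → i ∈ s
      · exact ⟨s, h0, fun i hi => hmono _ _ (hs i hi), Or.inl hall⟩
      · have hcard := hor.resolve_left hall
        push Not at hall
        obtain ⟨j, ⟨y, hyΩ, hyV⟩, hjs⟩ := hall
        obtain ⟨x0, hx0Ω, hx0V⟩ := hi0
        obtain ⟨x, hxΩ, hxU, hxW⟩ := hconn (⋃ i ∈ s, V i) (⋃ i ∈ {i | i ∉ s}, V i)
          (isOpen_biUnion fun i _ => hV i) (isOpen_biUnion fun i _ => hV i)
          (by
            intro x hx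
            obtain ⟨i, hi⟩ := mem_iUnion.1 (hcov hx)
            by_cases his : i ∈ s
            · exact Or.inl (mem_biUnion (s := {i | i ∈ s}) his hi)
            · exact Or.inr (mem_biUnion (s := {i | i ∉ s}) his hi))
          ⟨x0, hx0Ω, mem_biUnion (s := {i | i ∈ s}) h0 hx0V⟩
          ⟨y, hyΩ, mem_biUnion (s := {i | i ∉ s}) hjs hyV⟩
        simp only [mem_iUnion, mem_ofPred_eq, exists_prop] at hxU hxW
        obtain ⟨i, his, hxi⟩ := hxU
        obtain ⟨j', hj's, hxj⟩ := hxW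
        refine ⟨insert j' s, by simp [h0], ?_, Or.inr ?_⟩
        · intro l hl
          rcases Finset.mem_insert.1 hl with rfl | hl
          · exact hstep k i _ ⟨x, hxΩ, hxi, hxj⟩ (hs i his)
          · exact hmono _ _ (hs l hl)
        · rw [Finset.card_insert_of_notMem hj's]
          omega
  intro i hi
  obtain ⟨s, -, hs, hor⟩ := claim (Fintype.card ι)
  rcases hor with h | h
  · exact hs i (h i hi)
  · have := Finset.card_le_univ s
    omega

def Mseq (K M0 : ENNReal) : ℕ → ENNReal
  | 0 => M0
  | n + 1 => K * (K * (Mseq K M0 n + 1) + 1)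

lemma Mseq_mono (K M0 : ENNReal) (hK : 1 ≤ K) (n : ℕ) : Mseq K M0 n ≤ Mseq K M0 (n + 1) := by
  change _ ≤ K * (K * (Mseq K M0 n + 1) + 1)
  calc Mseq K M0 n ≤ Mseq K M0 n + 1 := le_self_add
    _ ≤ K * (Mseq K M0 n + 1) := le_mul_of_one_le_left (by positivity) hK
    _ ≤ K * (Mseq K M0 n + 1) + 1 := le_self_add
    _ ≤ _ := le_mul_of_one_le_left (by positivity) hK

lemma Mseq_fin (K M0 : ENNReal) (hK : K ≠ ⊤) (hM : M0 ≠ ⊤) (n : ℕ) : Mseq K M0 n ≠ ⊤ := by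
  induction n with
  | zero => exact hM
  | succ n ih =>
    change K * (K * (Mseq K M0 n + 1) + 1) ≠ ⊤
    finiteness

lemma main_lint (r₀ E₀ D₀ : ℝ) (hr₀ : 0 < r₀) (hE₀ : 0 < E₀) (hD₀ : 1 < D₀) :
    ∃ c : ENNReal, c ≠ 0 ∧ c ≠ ⊤ ∧ ∀ C : Set E3, IsLipschitzCavity r₀ E₀ D₀ C →
      ∀ u : E3 → E3, ContDiffOn ℝ 1 u (lowerHalf \ closure C) →
      ∫⁻ x in lowerHalf \ closure C, Wt x * Uf u x ≠ ⊤ →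
      ∫⁻ x in lowerHalf \ closure C, Wt x * Uf u x ≤
        c * ∫⁻ x in lowerHalf \ closure C, Gf u x := by
  obtain ⟨r, hr⟩ : ∃ r : ℝ, r = min r₀ 1 := ⟨_, rfl⟩
  obtain ⟨θ, hθ⟩ : ∃ θ : ℝ, θ = 1 / (2 * (1 + E₀)) := ⟨_, rfl⟩
  obtain ⟨σ, hσ⟩ : ∃ σ : ℝ, σ = θ * r / 10 := ⟨_, rfl⟩
  obtain ⟨K, hK⟩ : ∃ K : ℝ, K = 2 * ((θ / 4) ^ 3)⁻¹ := ⟨_, rfl⟩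
  have hrpos : 0 < r := by rw [hr]; exact lt_min hr₀ one_pos
  have hr1 : r ≤ 1 := by rw [hr]; exact min_le_right _ _
  have hθpos : 0 < θ := by rw [hθ]; positivity
  have hθ2 : θ ≤ 1 / 2 := by
    rw [hθ]
    apply one_div_le_one_div_of_le <;> linarith
  have hσpos : 0 < σ := by rw [hσ]; positivity
  have hσ1 : 20 * σ ≤ 1 := by rw [hσ]; nlinarith
  have hK1 : 1 ≤ ENNReal.ofReal K := by
    rw [ENNReal.one_le_ofReal, hK]
    have : 1 ≤ ((θ / 4) ^ 3)⁻¹ := by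
      apply (one_le_inv₀ (by positivity)).2
      apply pow_le_one₀ <;> linarith
    linarith
  obtain ⟨F, hFs, hFfin, hFcov⟩ := (isCompact_closedBall (0 : E3) (2 * D₀ + 1)).finite_cover_balls
    (half_pos hσpos)
  have : Fintype F := hFfin.fintype
  obtain ⟨B, hB⟩ : ∃ B : ℝ, B = 1 + (2 * D₀ + 3) ^ 2 := ⟨_, rfl⟩
  obtain ⟨M, hM⟩ : ∃ M : ℕ → ENNReal, M = Mseq (ENNReal.ofReal K) (ENNReal.ofReal B * 36) :=
    ⟨_, rfl⟩
  have hMfin : ∀ n, M n ≠ ⊤ := by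
    intro n; rw [hM]; exact Mseq_fin _ _ (by finiteness) (by finiteness) n
  set N := Fintype.card (Option F) with hN
  refine ⟨36 + Fintype.card F * M N, by simp, ?_, ?_⟩
  · have := hMfin N
    finiteness
  intro C hCav u
  obtain ⟨⟨hCo, hCb, hCl, hconn, hCneg, hCz, hCd⟩, hL⟩ := hCav
  obtain ⟨Ω, hΩe⟩ : ∃ Ω : Set E3, Ω = lowerHalf \ closure C := ⟨_, rfl⟩
  rw [← hΩe] at hconn ⊢
  intro hu hfin
  have hΩ : IsOpen Ω := by
    rw [hΩe]
    exact (isOpen_lt (coord_cont 2) continuous_const).sdiff isClosed_closure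
  have hclB : closure C ⊆ closedBall 0 (2 * D₀) := by
    apply closure_minimal _ isClosed_closedBall
    intro x hx
    rw [mem_closedBall_zero_iff]
    exact (hCneg hx).1.le
  have hfar : farSet (2 * D₀) ⊆ Ω := by
    rintro x ⟨h1, h2⟩
    rw [hΩe]
    refine ⟨h1, fun h3 => ?_⟩
    have := mem_closedBall_zero_iff.1 (hclB h3)
    linarith
  have hΩh : Ω ⊆ lowerHalf := by rw [hΩe]; exact sdiff_subset
  have hHardy := hardy hΩ hu (2 * D₀) (by linarith) hfar
    (ne_top_of_le_ne_top hfin (lintegral_mono_set hfar))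
  set G := ∫⁻ x in Ω, Gf u x with hG
  have hbase : ∀ p ∈ Ω, 2 * D₀ + 1 < ‖p‖ → ‖p‖ < 2 * D₀ + 2 →
      ∫⁻ x in Ω ∩ ball p σ, Uf u x ≤ M 0 * G := by
    intro p _ hp1 hp2
    have hnear : ∀ x ∈ ball p σ, ‖p‖ - 1 < ‖x‖ ∧ ‖x‖ < ‖p‖ + 1 := by
      intro x hx
      rw [mem_ball, dist_eq_norm] at hx
      have a1 := norm_sub_norm_le x p
      have a2 := norm_sub_norm_le p x
      rw [norm_sub_rev] at a2
      constructor <;> linarith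
    calc ∫⁻ x in Ω ∩ ball p σ, Uf u x
        ≤ ∫⁻ x in Ω ∩ ball p σ, ENNReal.ofReal B * (Wt x * Uf u x) := by
          apply setLIntegral_mono' (hΩ.inter isOpen_ball).measurableSet
          rintro x ⟨_, hx⟩
          rw [← mul_assoc]
          refine le_mul_of_one_le_left (by positivity) ?_
          rw [Wt, ← ENNReal.ofReal_mul (by rw [hB]; positivity), ENNReal.one_le_ofReal, mul_one_div,
            le_div_iff₀ (by positivity), one_mul, hB]
          have := (hnear x hx).2
          have : ‖x‖ ≤ 2 * D₀ + 3 := by linarith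
          gcongr
      _ ≤ ∫⁻ x in farSet (2 * D₀), ENNReal.ofReal B * (Wt x * Uf u x) := by
          apply lintegral_mono_set
          rintro x ⟨hx1, hx2⟩
          exact ⟨hΩh hx1, by linarith [(hnear x hx2).1]⟩
      _ = ENNReal.ofReal B * ∫⁻ x in farSet (2 * D₀), Wt x * Uf u x :=
          lintegral_const_mul' _ _ (by simp)
      _ ≤ ENNReal.ofReal B * (36 * G) := mul_le_mul' le_rfl hHardy
      _ = M 0 * G := by rw [hM, ← mul_assoc]; rfl
  let V : Option F → Set E3 := fun i => match i with
    | none => {x | 2 * D₀ + 1 < ‖x‖}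
    | some z => ball (z : E3) (σ / 2)
  have hMmono : ∀ n, M n ≤ M (n + 1) := by
    intro n; rw [hM]; exact Mseq_mono _ _ hK1 n
  have hM0 : ∀ n, M 0 ≤ M n := fun n => monotone_nat_of_le_succ hMmono (Nat.zero_le n)
  have hFn : ∀ z : F, ∀ x ∈ ball (z : E3) (σ / 2), ‖x‖ < 2 * D₀ + 2 := by
    intro z x hx
    have h1 := mem_closedBall_zero_iff.1 (hFs z.2)
    rw [mem_ball, dist_eq_norm] at hx
    have := norm_sub_norm_le x (z : E3)
    linarith
  have hchain := chain hconn.isPreconnected V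
    (by
      intro i
      match i with
      | none => exact isOpen_lt continuous_const continuous_norm
      | some z => exact isOpen_ball)
    (by
      intro x _
      by_cases hx : 2 * D₀ + 1 < ‖x‖
      · exact mem_iUnion.2 ⟨none, hx⟩
      · have := hFcov (mem_closedBall_zero_iff.2 (not_lt.1 hx))
        simp only [mem_iUnion, exists_prop] at this
        obtain ⟨z, hz, hxz⟩ := this
        exact mem_iUnion.2 ⟨some ⟨z, hz⟩, hxz⟩)
    (fun n i => ∀ p ∈ Ω ∩ V i, ‖p‖ < 2 * D₀ + 2 → ∫⁻ x in Ω ∩ ball p σ, Uf u x ≤ M n * G)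
    (by
      intro n i h p hp hp2
      exact (h p hp hp2).trans (mul_le_mul' (hMmono n) le_rfl))
    none
    (by
      have hnorm : ‖(EuclideanSpace.single 2 (-(2 * D₀ + 2)) : E3)‖ = 2 * D₀ + 2 := by
        rw [EuclideanSpace.norm_single, norm_neg, Real.norm_of_nonneg (by linarith)]
      refine ⟨EuclideanSpace.single 2 (-(2 * D₀ + 2)), hfar ⟨?_, ?_⟩, ?_⟩
      · simp; linarith
      · rw [hnorm]; linarith
      · change 2 * D₀ + 1 < _
        rw [hnorm]; linarith)
    (fun p hp hp2 => hbase p hp.1 hp.2 hp2)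
    (by
      rintro n i j ⟨x, hxΩ, hxi, hxj⟩ hQ p ⟨hpΩ, hpj⟩ hp2
      match j with
      | none => exact (hbase p hpΩ hpj hp2).trans (mul_le_mul' (hM0 _) le_rfl)
      | some z =>
        have hx2 := hFn z x hxj
        have h1 := hQ x ⟨hxΩ, hxi⟩ hx2
        have hd : dist x p < σ := by
          have a1 : dist x z < σ / 2 := hxj
          have a2 : dist p z < σ / 2 := hpj
          rw [dist_comm] at a2
          linarith [dist_triangle x z p]
        have h2 := step hr₀ hE₀ hD₀ hCz hL r θ σ K hr hθ hσ hK hΩe hΩ hu p x hpΩ hxΩ hd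
        refine h2.trans ?_
        rw [← hG]
        calc _ ≤ ENNReal.ofReal K * (ENNReal.ofReal K * (M n * G + G) + G) :=
              mul_le_mul' le_rfl (add_le_add (mul_le_mul' le_rfl (add_le_add h1 le_rfl)) le_rfl)
          _ = ENNReal.ofReal K * (ENNReal.ofReal K * (M n + 1) + 1) * G := by ring
          _ = M (n + 1) * G := by rw [hM]; rfl)
  have hpiece : ∀ z : F, ∫⁻ x in Ω ∩ ball (z : E3) (σ / 2), Wt x * Uf u x ≤ M N * G := by
    intro z
    by_cases hne : (Ω ∩ ball (z : E3) (σ / 2)).Nonempty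
    · obtain ⟨p, hp1, hp2⟩ := hne
      have h1 := hchain (some z) ⟨p, hp1, hp2⟩ p ⟨hp1, hp2⟩ (hFn z p hp2)
      refine le_trans ?_ h1
      calc _ ≤ ∫⁻ x in Ω ∩ ball (z : E3) (σ / 2), Uf u x := by
            apply lintegral_mono
            intro x
            refine mul_le_of_le_one_left (by positivity) ?_
            rw [Wt, ENNReal.ofReal_le_one]
            apply (div_le_one (by positivity)).2
            nlinarith [sq_nonneg ‖x‖]
        _ ≤ _ := by
            apply lintegral_mono_set
            refine inter_subset_inter_right _ ?_
            intro x hx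
            rw [mem_ball] at *
            rw [dist_comm] at hp2
            linarith [dist_triangle x z p]
    · rw [not_nonempty_iff_eq_empty] at hne
      rw [hne]; simp
  have hcover : Ω ⊆ farSet (2 * D₀) ∪ ⋃ z : F, (Ω ∩ ball (z : E3) (σ / 2)) := by
    intro x hx
    by_cases hx2 : 2 * D₀ + 1 < ‖x‖
    · exact Or.inl ⟨hΩh hx, by linarith⟩
    · have := hFcov (mem_closedBall_zero_iff.2 (not_lt.1 hx2))
      simp only [mem_iUnion, exists_prop] at this
      obtain ⟨z, hz, hxz⟩ := this
      exact Or.inr (mem_iUnion.2 ⟨⟨z, hz⟩, hx, hxz⟩)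
  calc ∫⁻ x in Ω, Wt x * Uf u x
      ≤ ∫⁻ x in farSet (2 * D₀) ∪ ⋃ z : F, (Ω ∩ ball (z : E3) (σ / 2)), Wt x * Uf u x :=
        lintegral_mono_set hcover
    _ ≤ _ := lintegral_union_le _ _ _
    _ ≤ 36 * G + ∑ z : F, ∫⁻ x in Ω ∩ ball (z : E3) (σ / 2), Wt x * Uf u x := by
        refine add_le_add hHardy ?_
        rw [← tsum_fintype (L := .unconditional F)]
        exact lintegral_iUnion_le _ _
    _ ≤ 36 * G + ∑ z : F, M N * G := by
        refine add_le_add le_rfl (Finset.sum_le_sum fun z _ => hpiece z)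
    _ = _ := by simp; ring

/-- Weighted Poincaré inequality in `ℝ³₋ \ C̄`. -/
theorem weighted_poincare (r₀ E₀ D₀ : ℝ) (hr₀ : 0 < r₀) (hE₀ : 0 < E₀) (hD₀ : 1 < D₀) :
    ∃ c : ℝ, 0 < c ∧ ∀ C : Set E3, IsLipschitzCavity r₀ E₀ D₀ C →
      ∀ u : E3 → E3, ContDiffOn ℝ 1 u (lowerHalf \ closure C) →
      IntegrableOn (fun x => ‖u x‖^2 / (1 + ‖x‖^2)) (lowerHalf \ closure C) →
      IntegrableOn (fun x => frob2 (jac u x)) (lowerHalf \ closure C) →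
      (∫ x in lowerHalf \ closure C, ‖u x‖^2 / (1 + ‖x‖^2)) ≤
        c * ∫ x in lowerHalf \ closure C, frob2 (jac u x) := by
  obtain ⟨c, hc0, hct, h⟩ := main_lint r₀ E₀ D₀ hr₀ hE₀ hD₀
  refine ⟨c.toReal, ENNReal.toReal_pos hc0 hct, ?_⟩
  intro C hC u hu h1 h2
  have hU : ENNReal.ofReal (∫ x in lowerHalf \ closure C, ‖u x‖^2 / (1 + ‖x‖^2)) =
      ∫⁻ x in lowerHalf \ closure C, Wt x * Uf u x := by
    rw [ofReal_integral_eq_lintegral_ofReal h1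
      (Filter.Eventually.of_forall fun x => by positivity)]
    congr 1
    ext x
    rw [Wt, Uf, ← ENNReal.ofReal_mul (by positivity)]
    congr 1
    ring
  have hG : ENNReal.ofReal (∫ x in lowerHalf \ closure C, frob2 (jac u x)) =
      ∫⁻ x in lowerHalf \ closure C, Gf u x := by
    rw [ofReal_integral_eq_lintegral_ofReal h2
      (Filter.Eventually.of_forall fun x => frob2_nonneg _)]
    rfl
  have h3 := h C hC u hu (by rw [← hU]; exact ENNReal.ofReal_ne_top)
  rw [← hU, ← hG, ← ENNReal.ofReal_toReal hct, ← ENNReal.ofReal_mul ENNReal.toReal_nonneg] at h3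
  exact (ENNReal.ofReal_le_ofReal_iff (mul_nonneg ENNReal.toReal_nonneg
    (integral_nonneg fun x => frob2_nonneg _))).1 h3

end
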